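/- Let p be a prime and n, m, s positive integers with s ∣ n, s ∣ m and s ≠ m. Let F = GaloisField p s, L = GaloisField p n, M = GaloisField p m, with fixed ring embeddings of F into L and into M, and regard the relative traces as maps Tr^n_s : L → F and Tr^m_s : M → F. For each i ∈ F, let: u_i, d_i be positive integers with u_i ≡ p^{j_i} (mod p^s − 1) for some 0 ≤ j_i ≤ s−1, gcd(u_i, p^n − 1) = 1 and d_i·u_i ≡ 1 (mod p^n − 1); ∘_i a presemifield multiplication on L admitting a dual ⋆_i that is right F-linear; α_i ∈ L \ {0}; κ_i ∈ F; and a_i : L × L → L with a_i(0,x₂) = 0 for all x₂ and a_i(x₁,x₂) ∘_i x₁^{u_i} = x₂ for all x₁ ≠ 0 and all x₂; and set F(i; x₁, x₂) = Tr^n_s(α_i·a_i(x₁,x₂)) + κ_i·(1 − x₁^{p^n−1}) ∈ F (the construction of Proposition 3). Let α, β ∈ M be linearly independent over F, R : M → M a bijection with R(0) = 0, and T : F → F arbitrary. Define H : L × L × M × M → F by H(x₁,x₂,y₁,y₂) = F(Tr^m_s(α·R(y₁·y₂^{p^m−2})); x₁, x₂) + Tr^m_s(β·R(y₁·y₂^{p^m−2}))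 + T(Tr^m_s(α·R(y₁·y₂^{p^m−2}))). Then the fiber partition {H⁻¹(i) : i ∈ F} is a bent partition of the (2n+2m)-dimensional 𝔽_p-space L × L × M × M satisfying Condition C with sign ε = 1: H(a•z) = H(z) for every a ∈ (ZMod p)ˣ and every z, and for every g : F → ZMod p each of whose fibers has exactly p^{s−1} elements, the function g ∘ H is weakly regular bent with sign 1, i.e., there exists (g∘H)* with ∑_{z} ζ_p^{(g∘H)(z) − ⟨w,z⟩} = p^{n+m}·ζ_p^{(g∘H)*(w)} for all w, where ⟨(w₁,w₂,v₁,v₂),(x₁,x₂,y₁,y₂)⟩ = Tr^n_1(w₁x₁ + w₂x₂) + Tr^m_1(v₁y₁ + v₂y₂). -/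

import Mathlib

open Finset

/-- `ζ_p^t = exp(2πi·t.val/p)` for `t : ZMod p`. -/
noncomputable def zetaP (p : ℕ) (t : ZMod p) : ℂ :=
  Complex.exp (2 * Real.pi * Complex.I * (t.val : ℂ) / (p : ℂ))

noncomputable instance (p n : ℕ) [Fact p.Prime] : Fintype (GaloisField p n) :=
  Fintype.ofFinite _

/-- The absolute trace of `GaloisField p n` down to `ZMod p`. -/
noncomputable def absTr (p n : ℕ) [Fact p.Prime] (x : GaloisField p n) : ZMod p :=
  Algebra.trace (ZMod p) (GaloisField p n) x

/-- The relative trace to the `p^s`-element subfield of `GaloisField p n`,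
`x ↦ ∑_{j=0}^{n/s−1} x^{(p^s)^j}`, as an element of `GaloisField p n`. -/
noncomputable def relTr (p n s : ℕ) [Fact p.Prime] (x : GaloisField p n) : GaloisField p n :=
  ∑ j ∈ Finset.range (n / s), x ^ (p ^ s) ^ j


section FiniteFieldSums

variable {F L M : Type*} [Field F] [Fintype F] [Field L] [Fintype L]
  [Field M] [Fintype M] [Algebra F L] [Algebra F M]

/-- Fourier inversion over a finite field. -/
theorem sum_fourier_mul_addChar {ψ : AddChar F ℂ} (hψ : ψ.IsPrimitive) (f : F → ℂ) (z : F) :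
    ∑ l : F, (∑ x : F, f x * ψ (-(l * x))) * ψ (l * z) = Fintype.card F * f z := by
  classical
  have h : ∀ l x : F, f x * ψ (-(l * x)) * ψ (l * z) = f x * ψ (l * (z - x)) := fun l x => by
    rw [mul_assoc, ← AddChar.map_add_eq_mul]
    ring_nf
  simp_rw [Finset.sum_mul, h]
  rw [Finset.sum_comm]
  simp_rw [← Finset.mul_sum, AddChar.sum_mulShift _ hψ, sub_eq_zero]
  simp [mul_comm]

/-- The Walsh transform of a function factoring through `a ↦ Tr(α a) + c`. -/
theorem card_mul_sum_trace_mul_addChar [DecidableEq L] {ψ : AddChar F ℂ} (hψ : ψ.IsPrimitive)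
    {ψL : AddChar L ℂ} (hψL : ψL.IsPrimitive) (htr : ∀ x, ψL x = ψ (Algebra.trace F L x))
    (f : F → ℂ) (α b : L) (c : F) :
    Fintype.card F * ∑ a : L, f (Algebra.trace F L (α * a) + c) * ψL (-(a * b)) =
      ∑ l : F, (∑ x : F, f x * ψ (-(l * x))) * ψ (l * c) *
        if l • α = b then (Fintype.card L : ℂ) else 0 := by
  rw [Finset.mul_sum]
  have h : ∀ (a : L) (l : F), ψ (l * (Algebra.trace F L (α * a) + c)) * ψL (-(a * b)) =
      ψ (l * c) * ψL (a * (l • α - b)) := fun a l => by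
    have : l * Algebra.trace F L (α * a) = Algebra.trace F L (a * (l • α)) := by
      rw [← smul_eq_mul, ← map_smul, mul_smul_comm, mul_comm]
    rw [mul_add, this, AddChar.map_add_eq_mul, ← htr, mul_sub, sub_eq_add_neg,
      AddChar.map_add_eq_mul]
    ring
  have h2 : ∀ l : F, ∑ a : L, ψL (a * (l • α - b)) =
      if l • α = b then (Fintype.card L : ℂ) else 0 := fun l => by
    rw [AddChar.sum_mulShift _ hψL]
    simp [sub_eq_zero]
  simp_rw [← h2, Finset.mul_sum]
  rw [Finset.sum_comm]
  refine Finset.sum_congr rfl fun a _ => ?_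
  rw [← mul_assoc, ← sum_fourier_mul_addChar hψ f, Finset.sum_mul]
  exact Finset.sum_congr rfl fun l _ => by rw [mul_assoc, h, mul_assoc]

/-- For a nonzero left argument, the dual of a presemifield multiplication is injective
in the right argument. -/
theorem injective_dual_of_presemifield {ψL : AddChar L ℂ} (hψL : ψL.IsPrimitive)
    {mul str : L → L → L} (hl : ∀ x y z, mul (x + y) z = mul x z + mul y z)
    (hr : ∀ x y z, mul z (x + y) = mul z x + mul z y)
    (h0 : ∀ x y, mul x y = 0 → x = 0 ∨ y = 0)
    (hdual : ∀ x y z, ψL (z * mul x y) = ψL (x * str z y)) {w : L} (hw : w ≠ 0) :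
    Function.Injective (str w) := by
  have inj : ∀ y, y ≠ 0 → Function.Injective fun x => mul x y := fun y hy =>
    (injective_iff_map_eq_zero (AddMonoidHom.mk' (fun x => mul x y) fun x x' => hl x x' y)).2
      fun x hx => (h0 x y hx).resolve_right hy
  intro y y' hyy
  by_contra hne
  have hne' : y - y' ≠ 0 := sub_ne_zero.2 hne
  have surj := Finite.injective_iff_surjective.1 (inj _ hne')
  refine hψL hw (DFunLike.ext _ _ fun t => ?_)
  obtain ⟨x, rfl⟩ := surj t
  have h1 : mul x y = mul x (y - y') + mul x y' := by rw [← hr, sub_add_cancel]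
  have h2 : ψL (w * mul x y) = ψL (w * mul x y') := by rw [hdual, hdual, hyy]
  rw [h1, mul_add, AddChar.map_add_eq_mul] at h2
  simpa [AddChar.mulShift_apply] using
    mul_right_cancel₀ (AddChar.val_isUnit _ _).ne_zero (h2.trans (one_mul _).symm)

/-- The functions `Tr(α a(x₁, x₂)) + κ (1 - x₁ ^ (q - 1))` built from a presemifield are
vectorial dual-bent with sign `1`. -/
theorem exists_walsh_eq_of_presemifield {ψ : AddChar F ℂ} (hψ : ψ.IsPrimitive)
    {ψL : AddChar L ℂ} (hψL : ψL.IsPrimitive) (htr : ∀ x, ψL x = ψ (Algebra.trace F L x))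
    {r u : ℕ} (hrs : Function.Surjective fun x : F => x ^ r) (hψr : ∀ x, ψ (x ^ r) = ψ x)
    (hur : ∀ x : F, x ^ u = x ^ r) (hu : u ≠ 0) (hui : Function.Injective fun x : L => x ^ u)
    {mul str : L → L → L} (hl : ∀ x y z, mul (x + y) z = mul x z + mul y z)
    (hr : ∀ x y z, mul z (x + y) = mul z x + mul z y)
    (h0 : ∀ x y, mul x y = 0 → x = 0 ∨ y = 0)
    (hdual : ∀ x y z, ψL (z * mul x y) = ψL (x * str z y))
    (hlin : ∀ (x y : L) (c : F), str x (c • y) = c • str x y)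
    {α : L} (hα : α ≠ 0) (κ : F) {a : L → L → L}
    (ha : ∀ x₁ x₂, x₁ ≠ 0 → mul (a x₁ x₂) (x₁ ^ u) = x₂)
    {Φ : L → L → F} (hΦ0 : ∀ x, Φ 0 x = κ)
    (hΦ : ∀ x₁ x₂, x₁ ≠ 0 → Φ x₁ x₂ = Algebra.trace F L (α * a x₁ x₂)) (w₁ w₂ : L) :
    ∃ G : F, ∀ f : F → ℂ, ∑ z, f z = 0 → ∀ c : F,
      ∑ x₁ : L, ∑ x₂ : L, f (Φ x₁ x₂ + c) * ψL (-(w₁ * x₁ + w₂ * x₂)) =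
        Fintype.card L * f (G + c) := by
  classical
  have hstr0 : ∀ x, str x 0 = 0 := fun x => by simpa using hlin x 0 0
  have hstr0' : ∀ y, str 0 y = 0 := fun y => by
    by_contra hne
    refine hψL hne (DFunLike.ext _ _ fun t => ?_)
    rw [AddChar.mulShift_apply, mul_comm, ← hdual]
    simp
  have hF0 : (Fintype.card F : ℂ) ≠ 0 := Nat.cast_ne_zero.2 Fintype.card_ne_zero
  have key : ∀ f : F → ℂ, ∑ z, f z = 0 → ∀ (c : F) (x₁ : L),
      Fintype.card F * ∑ x₂ : L, f (Φ x₁ x₂ + c) * ψL (-(w₁ * x₁ + w₂ * x₂)) =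
        (if x₁ = 0 then Fintype.card F * f (κ + c) *
          (if w₂ = 0 then (Fintype.card L : ℂ) else 0) else 0) +
        ψL (-(w₁ * x₁)) * ∑ l : F, (∑ x : F, f x * ψ (-(l * x))) * ψ (l * c) *
          if l • α = str w₂ (x₁ ^ u) then (Fintype.card L : ℂ) else 0 := by
    intro f hf c x₁
    by_cases hx : x₁ = 0
    · subst hx
      have e2 : ∑ l : F, (∑ x : F, f x * ψ (-(l * x))) * ψ (l * c) *
          (if l • α = str w₂ (0 ^ u) then (Fintype.card L : ℂ) else 0) = 0 := by
        refine Finset.sum_eq_zero fun l _ => ?_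
        rw [zero_pow hu, hstr0]
        by_cases hl0 : l = 0
        · simp [hl0, hf]
        · simp [hl0, hα]
      have e3 := AddChar.sum_mulShift (-w₂) hψL
      simp only [mul_neg, neg_eq_zero] at e3
      rw [e2]
      simp only [hΦ0, mul_zero, zero_add, ← Finset.mul_sum, mul_comm w₂, e3, if_true]
      push_cast
      ring
    · rw [if_neg hx, zero_add, ← card_mul_sum_trace_mul_addChar hψ hψL htr, mul_left_comm]
      congr 1
      rw [Finset.mul_sum]
      have inj : Function.Injective fun b => mul b (x₁ ^ u) :=
        (injective_iff_map_eq_zero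
          (AddMonoidHom.mk' (fun b => mul b (x₁ ^ u)) fun b b' => hl b b' _)).2
          fun b hb => (h0 b _ hb).resolve_right (pow_ne_zero _ hx)
      refine (Fintype.sum_bijective _ (Finite.injective_iff_bijective.1 inj) _ _
        fun b => ?_).symm
      have hab : a x₁ (mul b (x₁ ^ u)) = b := inj (ha _ _ hx)
      rw [hΦ _ _ hx, hab, neg_add, AddChar.map_add_eq_mul, AddChar.map_neg_eq_inv ψL (w₂ * _),
        hdual, ← AddChar.map_neg_eq_inv]
      ring
  by_cases hw : w₂ = 0
  · refine ⟨κ, fun f hf c => mul_left_cancel₀ hF0 ?_⟩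
    rw [Finset.mul_sum]
    simp_rw [key f hf c, hw, hstr0']
    rw [Finset.sum_add_distrib, Finset.sum_ite_eq' Finset.univ, if_pos (Finset.mem_univ _),
      if_pos trivial, Finset.sum_eq_zero, add_zero]
    · ring
    · intro x _
      rw [Finset.sum_eq_zero, mul_zero]
      intro l _
      by_cases hl0 : l = 0
      · simp [hl0, hf]
      · simp [hl0, hα]
  · have hinj : Function.Injective fun x : L => str w₂ (x ^ u) :=
      (injective_dual_of_presemifield hψL hl hr h0 hdual hw).comp hui
    obtain ⟨x₀, hx₀⟩ := Finite.injective_iff_surjective.1 hinj α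
    refine ⟨-(Algebra.trace F L (w₁ * x₀)) ^ r, fun f hf c => mul_left_cancel₀ hF0 ?_⟩
    rw [Finset.mul_sum]
    simp_rw [key f hf c, if_neg hw, mul_zero, ite_self, zero_add, Finset.mul_sum]
    rw [Finset.sum_comm, mul_left_comm, ← sum_fourier_mul_addChar hψ f, Finset.mul_sum]
    refine Finset.sum_congr rfl fun l _ => ?_
    obtain ⟨μ, rfl⟩ := hrs l
    have h : ∀ x : L, μ ^ r • α = str w₂ (x ^ u) ↔ μ • x₀ = x := fun x => by
      have h1 : str w₂ ((μ • x₀) ^ u) = μ ^ r • α := by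
        rw [smul_pow, hlin, hur]
        exact congrArg _ hx₀
      rw [← h1]
      exact hinj.eq_iff
    have h3 : ψL (-(w₁ * μ • x₀)) = ψ (μ ^ r * -(Algebra.trace F L (w₁ * x₀)) ^ r) := by
      rw [mul_neg, ← mul_pow, AddChar.map_neg_eq_inv, AddChar.map_neg_eq_inv, hψr, htr,
        mul_smul_comm, map_smul, smul_eq_mul]
    simp only [h, mul_ite, mul_zero]
    rw [Finset.sum_ite_eq, if_pos (Finset.mem_univ _), h3, mul_add, AddChar.map_add_eq_mul]
    ring

/-- The Walsh transform of a balanced function of `y₁ / y₂` (the Desarguesian spread). -/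
theorem sum_spread_mul_addChar {ψM : AddChar M ℂ} (hψM : ψM.IsPrimitive) (k : M → ℂ)
    (hk : ∑ t, k t = 0) (v₁ v₂ : M) :
    ∑ y₁ : M, ∑ y₂ : M, k (y₁ * y₂⁻¹) * ψM (-(v₁ * y₁ + v₂ * y₂)) =
      Fintype.card M * k (-(v₂ * v₁⁻¹)) := by
  classical
  rw [Finset.sum_comm]
  have h : ∀ y₂ : M, ∑ y₁ : M, k (y₁ * y₂⁻¹) * ψM (-(v₁ * y₁ + v₂ * y₂)) =
      ∑ t : M, k t * ψM (y₂ * -(v₁ * t + v₂)) +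
        if y₂ = 0 then k 0 * (if v₁ = 0 then (Fintype.card M : ℂ) else 0) else 0 := by
    intro y₂
    by_cases hy : y₂ = 0
    · have e3 := AddChar.sum_mulShift (-v₁) hψM
      simp only [mul_neg, neg_eq_zero] at e3
      simp only [hy, inv_zero, mul_zero, add_zero, zero_mul, AddChar.map_zero_eq_one, mul_one,
        hk, zero_add, ← Finset.mul_sum, mul_comm v₁, e3, if_true]
      push_cast
      rfl
    · rw [if_neg hy, add_zero]
      refine (Fintype.sum_bijective _ (mulRight_bijective₀ y₂ hy) _ _ fun t => ?_).symm
      rw [mul_inv_cancel_right₀ hy]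
      ring_nf
  simp_rw [h]
  rw [Finset.sum_add_distrib, Finset.sum_ite_eq' Finset.univ, if_pos (Finset.mem_univ _),
    Finset.sum_comm]
  simp_rw [← Finset.mul_sum, AddChar.sum_mulShift _ hψM, neg_eq_zero]
  by_cases hv : v₁ = 0
  · by_cases hv2 : v₂ = 0
    · simp [hv, hv2, ← Finset.sum_mul, hk, mul_comm]
    · simp [hv, hv2, mul_comm]
  · have : ∀ t, v₁ * t + v₂ = 0 ↔ t = -(v₂ * v₁⁻¹) := fun t => by
      constructor
      · intro ht
        field_simp
        linear_combination ht
      · rintro rfl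
        field_simp
        ring
    simp [this, hv, mul_comm]

/-- For `α, β` linearly independent, `Tr(β r) + B(Tr(α r))` is balanced. -/
theorem sum_comp_trace_eq_zero {α β : M}
    (hαβ : ∀ c₁ c₂ : F, c₁ • α + c₂ • β = 0 → c₁ = 0 ∧ c₂ = 0) (f : F → ℂ)
    (hf : ∑ z, f z = 0) (B : F → F) :
    ∑ r : M, f (B (Algebra.trace F M (α * r)) + Algebra.trace F M (β * r)) = 0 := by
  obtain ⟨r₀, h1, h2⟩ : ∃ r₀, Algebra.trace F M (α * r₀) = 0 ∧
      Algebra.trace F M (β * r₀) ≠ 0 := by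
    by_contra! hcon
    have hmem := FiniteDimensional.mem_span_of_iInf_ker_le_ker
      (L := fun _ : Unit => Algebra.traceForm F M α) (K := Algebra.traceForm F M β) (by
        intro x hx
        simpa using hcon x (by simpa using hx))
    rw [Set.range_const, Submodule.mem_span_singleton] at hmem
    obtain ⟨c, hc⟩ := hmem
    have h0 : c • α - β = 0 := (traceForm_nondegenerate F M).1 _ fun y => by
      rw [map_sub, map_smul, hc, sub_self, LinearMap.zero_apply]
    have := (hαβ c (-1) (by rw [← h0, neg_one_smul, sub_eq_add_neg])).2
    simp at this
  have hF0 : (Fintype.card F : ℂ) ≠ 0 := Nat.cast_ne_zero.2 Fintype.card_ne_zero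
  refine (mul_eq_zero.1 ?_).resolve_left hF0
  have shift : ∀ μ : F,
      ∑ r : M, f (B (Algebra.trace F M (α * r)) + Algebra.trace F M (β * r)) =
      ∑ r : M, f (B (Algebra.trace F M (α * r)) + Algebra.trace F M (β * r) +
        μ * Algebra.trace F M (β * r₀)) := fun μ => by
    refine (Fintype.sum_equiv (Equiv.addRight (μ • r₀)) _ _ fun r => ?_).symm
    simp [mul_add, h1, add_assoc]
  rw [← nsmul_eq_mul, ← Finset.card_univ, ← Finset.sum_const,
    Finset.sum_congr rfl fun μ _ => shift μ, Finset.sum_comm]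
  refine Finset.sum_eq_zero fun r _ => ?_
  rw [← hf]
  exact Fintype.sum_bijective _ ((AddGroup.addLeft_bijective _).comp (mulRight_bijective₀ _ h2)) _ _
    fun μ => rfl

end FiniteFieldSums
section GaloisField

variable (p : ℕ) [hp : Fact p.Prime]

theorem zetaP_eq_stdAddChar (t : ZMod p) : zetaP p t = ZMod.stdAddChar t := by
  rw [ZMod.stdAddChar_apply, ZMod.toCircle_apply]
  rfl

/-- The canonical additive character of `GaloisField p n`. -/
noncomputable def galoisChar (n : ℕ) : AddChar (GaloisField p n) ℂ :=
  (ZMod.stdAddChar (N := p)).compAddMonoidHom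
    (Algebra.trace (ZMod p) (GaloisField p n)).toAddMonoidHom

theorem galoisChar_apply (n : ℕ) (x : GaloisField p n) :
    galoisChar p n x = ZMod.stdAddChar (absTr p n x) := rfl

theorem isPrimitive_galoisChar (n : ℕ) : (galoisChar p n).IsPrimitive := by
  refine AddChar.IsPrimitive.of_ne_one fun h => ?_
  obtain ⟨x, hx⟩ := Algebra.trace_surjective (ZMod p) (GaloisField p n) 1
  have h1 := DFunLike.congr_fun h x
  rw [galoisChar_apply, absTr, hx, AddChar.one_apply, ← AddChar.map_zero_eq_one (ZMod.stdAddChar (N := p))]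
    at h1
  exact one_ne_zero (ZMod.injective_stdAddChar h1)

theorem card_galoisField {n : ℕ} (hn : 0 < n) : Fintype.card (GaloisField p n) = p ^ n := by
  rw [← Nat.card_eq_fintype_card, GaloisField.card p n hn.ne']

theorem pow_card_sub_one_galoisField {n : ℕ} (hn : 0 < n) {x : GaloisField p n} (hx : x ≠ 0) :
    x ^ (p ^ n - 1) = 1 := by
  rw [← card_galoisField p hn, FiniteField.pow_card_sub_one_eq_one x hx]

theorem galoisChar_pow (n j : ℕ) (x : GaloisField p n) :
    galoisChar p n (x ^ p ^ j) = galoisChar p n x := by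
  induction j with
  | zero => simp
  | succ j ih =>
    rw [pow_succ, pow_mul, ← ih, galoisChar_apply, galoisChar_apply, absTr, absTr]
    have h := Algebra.trace_eq_of_algEquiv
      (FiniteField.frobeniusAlgEquivOfAlgebraic (ZMod p) (GaloisField p n)) (x ^ p ^ j)
    rw [FiniteField.coe_frobeniusAlgEquivOfAlgebraic, ZMod.card] at h
    rw [h]

theorem surjective_pow_galoisField (n j : ℕ) :
    Function.Surjective fun x : GaloisField p n => x ^ p ^ j :=
  Finite.injective_iff_surjective.1 (iterateFrobenius_inj (GaloisField p n) p j)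

theorem pow_card_sub_two_galoisField {m : ℕ} (hm : 1 < m) (y : GaloisField p m) :
    y ^ (p ^ m - 2) = y⁻¹ := by
  have h4 : 2 ^ 2 ≤ p ^ m :=
    (Nat.pow_le_pow_left hp.out.two_le 2).trans (Nat.pow_le_pow_right hp.out.pos hm)
  by_cases hy : y = 0
  · rw [hy, zero_pow (by omega), inv_zero]
  · refine eq_inv_of_mul_eq_one_left ?_
    rw [← pow_succ, ← pow_card_sub_one_galoisField p (by omega) hy]
    congr 1
    omega

/-- A map with fibers of equal size `N` into `ZMod p` has vanishing exponential sum. -/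
theorem sum_stdAddChar_eq_zero_of_card_fiber {ι : Type*} [Fintype ι] (g : ι → ZMod p) (N : ℕ)
    (hg : ∀ c, (Finset.univ.filter fun i => g i = c).card = N) :
    ∑ i, (ZMod.stdAddChar (g i) : ℂ) = 0 := by
  have h1 : (ZMod.stdAddChar (N := p)) ≠ 1 := fun h => by
    have h2 := DFunLike.congr_fun h 1
    rw [AddChar.one_apply, ← AddChar.map_zero_eq_one (ZMod.stdAddChar (N := p))] at h2
    exact one_ne_zero (ZMod.injective_stdAddChar h2)
  rw [← Finset.sum_fiberwise Finset.univ g]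
  have h3 : ∀ c, ∑ i ∈ Finset.univ.filter (fun i => g i = c), (ZMod.stdAddChar (g i) : ℂ) =
      N * ZMod.stdAddChar c := fun c => by
    rw [Finset.sum_congr rfl fun i hi => by rw [(Finset.mem_filter.1 hi).2], Finset.sum_const,
      hg, nsmul_eq_mul]
  simp_rw [h3, ← Finset.mul_sum, AddChar.sum_eq_zero_of_ne_one h1, mul_zero]

variable {n s : ℕ} [Algebra (GaloisField p s) (GaloisField p n)]

instance isScalarTower_galoisField :
    IsScalarTower (ZMod p) (GaloisField p s) (GaloisField p n) :=
  IsScalarTower.of_algebraMap_eq' (Subsingleton.elim _ _)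

theorem galoisChar_eq_galoisChar_trace (x : GaloisField p n) :
    galoisChar p n x =
      galoisChar p s (Algebra.trace (GaloisField p s) (GaloisField p n) x) := by
  rw [galoisChar_apply, galoisChar_apply, absTr, absTr, Algebra.trace_trace]

theorem algebraMap_trace_galoisField (hn : 0 < n) (hs : 0 < s) (x : GaloisField p n) :
    algebraMap _ _ (Algebra.trace (GaloisField p s) (GaloisField p n) x) =
      ∑ j ∈ Finset.range (n / s), x ^ (p ^ s) ^ j := by
  have h := Module.finrank_mul_finrank (ZMod p) (GaloisField p s) (GaloisField p n)
  rw [GaloisField.finrank p hs.ne', GaloisField.finrank p hn.ne'] at h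
  have h2 : n / s = Module.finrank (GaloisField p s) (GaloisField p n) := by
    conv_lhs => rw [← h]
    exact Nat.mul_div_cancel_left _ hs
  rw [FiniteField.algebraMap_trace_eq_sum_pow, h2, GaloisField.card p s hs.ne']

end GaloisField

/-- Move the last two of four finite summations to the front. -/
theorem sum_comm_pairs {A B C D : Type*} [Fintype A] [Fintype B] [Fintype C] [Fintype D]
    (f : A → B → C → D → ℂ) :
    ∑ a, ∑ b, ∑ c, ∑ d, f a b c d = ∑ c, ∑ d, ∑ a, ∑ b, f a b c d := by
  have h : ∀ a, ∑ b, ∑ c, ∑ d, f a b c d = ∑ c, ∑ d, ∑ b, f a b c d := fun a =>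
    Finset.sum_comm.trans (Finset.sum_congr rfl fun _ _ => Finset.sum_comm)
  simp_rw [h]
  exact Finset.sum_comm.trans (Finset.sum_congr rfl fun _ _ => Finset.sum_comm)

theorem stmt11 (p : ℕ) [Fact p.Prime] (n m s : ℕ) (hn : 0 < n) (hm : 0 < m) (hs : 0 < s)
    (hsn : s ∣ n) (hsm : s ∣ m) (hsne : s ≠ m)
    -- fixed ring embeddings of `F = GaloisField p s` into `L = GaloisField p n`
    -- and into `M = GaloisField p m`
    (ιL : GaloisField p s →+* GaloisField p n)
    (ιM : GaloisField p s →+* GaloisField p m)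
    -- the relative trace `Tr^m_s : M → F`
    (trms : GaloisField p m → GaloisField p s)
    (htrms : ∀ z : GaloisField p m,
      ιM (trms z) = ∑ j ∈ Finset.range (m / s), z ^ (p ^ s) ^ j)
    -- for each `i ∈ F`: exponents `u i`, `d i`
    (u d : GaloisField p s → ℕ) (hu : ∀ i, 0 < u i) (hd : ∀ i, 0 < d i)
    (j : GaloisField p s → ℕ) (hj : ∀ i, j i < s)
    (hmod : ∀ i, u i ≡ p ^ j i [MOD p ^ s - 1])
    (hgcd : ∀ i, Nat.gcd (u i) (p ^ n - 1) = 1)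
    (hdu : ∀ i, d i * u i ≡ 1 [MOD p ^ n - 1])
    -- for each `i ∈ F`: a presemifield multiplication `∘ᵢ` on `L`
    (mul : GaloisField p s → GaloisField p n → GaloisField p n → GaloisField p n)
    (hmul_addl : ∀ i x y z, mul i (x + y) z = mul i x z + mul i y z)
    (hmul_addr : ∀ i x y z, mul i z (x + y) = mul i z x + mul i z y)
    (hmul_zero : ∀ i x y, mul i x y = 0 → x = 0 ∨ y = 0)
    -- admitting a dual `⋆ᵢ` that is right `F`-linear
    (str : GaloisField p s → GaloisField p n → GaloisField p n → GaloisField p n)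
    (hdual : ∀ i x y z, absTr p n (z * mul i x y) = absTr p n (x * str i z y))
    (hlin : ∀ i (x y : GaloisField p n) (c : GaloisField p s),
      str i x (ιL c * y) = ιL c * str i x y)
    -- for each `i ∈ F`: `αᵢ ∈ L \ {0}` and `κᵢ ∈ F`
    (α' : GaloisField p s → GaloisField p n) (hα' : ∀ i, α' i ≠ 0)
    (κ : GaloisField p s → GaloisField p s)
    -- for each `i ∈ F`: the function `aᵢ(x₁,x₂)`
    (a : GaloisField p s → GaloisField p n → GaloisField p n → GaloisField p n)
    (ha0 : ∀ i x₂, a i 0 x₂ = 0)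
    (ha : ∀ i x₁ x₂, x₁ ≠ 0 → mul i (a i x₁ x₂) (x₁ ^ u i) = x₂)
    -- `F(i; x₁, x₂) = Tr^n_s(αᵢ·aᵢ(x₁,x₂)) + κᵢ·(1 − x₁^{p^n−1})`, `F`-valued
    (Fi : GaloisField p s → GaloisField p n → GaloisField p n → GaloisField p s)
    (hFi : ∀ i x₁ x₂, ιL (Fi i x₁ x₂) =
      relTr p n s (α' i * a i x₁ x₂) + ιL (κ i) * (1 - x₁ ^ (p ^ n - 1)))
    -- `α, β ∈ M` linearly independent over `F`
    (α β : GaloisField p m)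
    (hαβ : ∀ c₁ c₂ : GaloisField p s, ιM c₁ * α + ιM c₂ * β = 0 → c₁ = 0 ∧ c₂ = 0)
    -- a bijection `R` of `M` with `R(0) = 0`, and an arbitrary `T : F → F`
    (R : GaloisField p m → GaloisField p m) (hR : Function.Bijective R) (hR0 : R 0 = 0)
    (T : GaloisField p s → GaloisField p s)
    -- the function `H(x₁,x₂,y₁,y₂)`
    (H : GaloisField p n → GaloisField p n → GaloisField p m → GaloisField p m →
      GaloisField p s)
    (hH : ∀ x₁ x₂ y₁ y₂, H x₁ x₂ y₁ y₂ =
      Fi (trms (α * R (y₁ * y₂ ^ (p ^ m - 2)))) x₁ x₂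
        + trms (β * R (y₁ * y₂ ^ (p ^ m - 2)))
        + T (trms (α * R (y₁ * y₂ ^ (p ^ m - 2))))) :
    -- the fiber partition of `H` is a bent partition satisfying Condition C with sign `1`:
    -- `H` is invariant under nonzero scalar multiplication
    (∀ (c : (ZMod p)ˣ) (x₁ x₂ : GaloisField p n) (y₁ y₂ : GaloisField p m),
      H ((c : ZMod p) • x₁) ((c : ZMod p) • x₂) ((c : ZMod p) • y₁) ((c : ZMod p) • y₂)
        = H x₁ x₂ y₁ y₂) ∧
    -- and every balanced combination of the fibers is weakly regular bent with sign `1`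
    (∀ g : GaloisField p s → ZMod p,
      (∀ c : ZMod p, (Finset.univ.filter (fun i => g i = c)).card = p ^ (s - 1)) →
      ∃ gd : GaloisField p n → GaloisField p n → GaloisField p m → GaloisField p m →
          ZMod p,
        ∀ (w₁ w₂ : GaloisField p n) (v₁ v₂ : GaloisField p m),
          (∑ x₁ : GaloisField p n, ∑ x₂ : GaloisField p n,
            ∑ y₁ : GaloisField p m, ∑ y₂ : GaloisField p m,
              zetaP p (g (H x₁ x₂ y₁ y₂)
                - (absTr p n (w₁ * x₁ + w₂ * x₂) + absTr p m (v₁ * y₁ + v₂ * y₂)))) =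
            (p : ℂ) ^ (n + m) * zetaP p (gd w₁ w₂ v₁ v₂)) := by
  classical
  have hp : p.Prime := Fact.out
  let algL : Algebra (GaloisField p s) (GaloisField p n) := ιL.toAlgebra
  let algM : Algebra (GaloisField p s) (GaloisField p m) := ιM.toAlgebra
  have hm2 : 1 < m := by
    have := Nat.le_of_dvd hm hsm
    omega
  have htrms' : trms = Algebra.trace (GaloisField p s) (GaloisField p m) := funext fun z =>
    ιM.injective ((htrms z).trans (algebraMap_trace_galoisField p hm hs z).symm)
  have hrel : ∀ x, relTr p n s x =
      ιL (Algebra.trace (GaloisField p s) (GaloisField p n) x) := fun x =>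
    (algebraMap_trace_galoisField p hn hs x).symm
  have hF0 : ∀ i x, Fi i 0 x = κ i := fun i x => ιL.injective <| by
    have : p ^ n - 1 ≠ 0 := (Nat.sub_pos_of_lt (Nat.one_lt_pow hn.ne' hp.one_lt)).ne'
    rw [hFi, ha0, hrel, zero_pow this]
    simp
  have hF1 : ∀ i x₁ x₂, x₁ ≠ 0 → Fi i x₁ x₂ =
      Algebra.trace (GaloisField p s) (GaloisField p n) (α' i * a i x₁ x₂) :=
    fun i x₁ x₂ hx => ιL.injective <| by
      rw [hFi, hrel, pow_card_sub_one_galoisField p hn hx]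
      simp
  simp only [pow_card_sub_two_galoisField p hm2, htrms'] at hH
  refine ⟨fun c x₁ x₂ y₁ y₂ => ?_, fun g hg => ?_⟩
  · have hc : (c : ZMod p) ≠ 0 := c.ne_zero
    have hy : ((c : ZMod p) • y₁) * ((c : ZMod p) • y₂)⁻¹ = y₁ * y₂⁻¹ := by
      have hc' : algebraMap (ZMod p) (GaloisField p m) c ≠ 0 := by simp
      rw [Algebra.smul_def, Algebra.smul_def, mul_inv_rev]
      field_simp
    have hF : ∀ i, Fi i ((c : ZMod p) • x₁) ((c : ZMod p) • x₂) = Fi i x₁ x₂ := fun i => by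
      by_cases hx : x₁ = 0
      · rw [hx, smul_zero, hF0, hF0]
      · have hcx : (c : ZMod p) • x₁ ≠ 0 := smul_ne_zero hc hx
        rw [hF1 _ _ _ hx, hF1 _ _ _ hcx]
        have hcu : (c : ZMod p) ^ u i = c := by
          have h1 : (c : ZMod p) ^ (p ^ s - 1) = 1 := by
            obtain ⟨k, hk⟩ := Nat.sub_dvd_pow_sub_pow p 1 s
            rw [one_pow] at hk
            rw [hk, pow_mul, ZMod.pow_card_sub_one_eq_one hc, one_pow]
          rw [pow_eq_pow_of_modEq (hmod i) h1, ZMod.pow_card_pow]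
        have inj : Function.Injective fun b => mul i b ((c : ZMod p) • x₁ ^ u i) :=
          (injective_iff_map_eq_zero
            (AddMonoidHom.mk' (fun b => mul i b ((c : ZMod p) • x₁ ^ u i))
              fun b b' => hmul_addl i b b' _)).2
            fun b hb => (hmul_zero i b _ hb).resolve_right (smul_ne_zero hc (pow_ne_zero _ hx))
        congr 2
        refine inj ?_
        have h2 := ha i _ ((c : ZMod p) • x₂) hcx
        rw [smul_pow, hcu] at h2
        have h3 := ZMod.map_smul (AddMonoidHom.mk' (fun y => mul i (a i x₁ x₂) y)
          fun y y' => hmul_addr i y y' _) (c : ZMod p) (x₁ ^ u i)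
        simp only [AddMonoidHom.mk'_apply, ha i _ _ hx] at h3
        exact h2.trans h3.symm
    rw [hH, hH, hy, hF]
  · have hbal : ∑ z, (ZMod.stdAddChar (g z) : ℂ) = 0 :=
      sum_stdAddChar_eq_zero_of_card_fiber p g _ hg
    have hui : ∀ i, Function.Injective fun x : GaloisField p n => x ^ u i := fun i => by
      refine Function.LeftInverse.injective (g := fun x => x ^ d i) fun x => ?_
      simp only
      rw [← pow_mul, mul_comm]
      by_cases hx : x = 0
      · rw [hx, zero_pow (Nat.mul_pos (hd i) (hu i)).ne']
      · rw [pow_eq_pow_of_modEq (hdu i) (pow_card_sub_one_galoisField p hn hx), pow_one]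
    have hur : ∀ i, ∀ x : GaloisField p s, x ^ u i = x ^ p ^ j i := fun i x => by
      by_cases hx : x = 0
      · rw [hx, zero_pow (hu i).ne', zero_pow (pow_ne_zero _ hp.ne_zero)]
      · exact pow_eq_pow_of_modEq (hmod i) (pow_card_sub_one_galoisField p hs hx)
    choose G hG using fun i => exists_walsh_eq_of_presemifield (isPrimitive_galoisChar p s)
      (isPrimitive_galoisChar p n) (galoisChar_eq_galoisChar_trace p)
      (surjective_pow_galoisField p s (j i)) (galoisChar_pow p s (j i)) (hur i) (hu i).ne' (hui i)
      (hmul_addl i) (hmul_addr i) (hmul_zero i)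
      (fun x y z => by rw [galoisChar_apply, galoisChar_apply, hdual i])
      (fun x y c => hlin i x y c) (hα' i) (κ i) (ha i) (hF0 i) (hF1 i)
    let k : GaloisField p n → GaloisField p n → GaloisField p m → GaloisField p s :=
      fun w₁ w₂ t => G (Algebra.trace _ _ (α * R t)) w₁ w₂ +
        (Algebra.trace _ _ (β * R t) + T (Algebra.trace _ _ (α * R t)))
    have hk : ∀ w₁ w₂, ∑ t, (ZMod.stdAddChar (g (k w₁ w₂ t)) : ℂ) = 0 := fun w₁ w₂ => by
      have h := sum_comp_trace_eq_zero (α := α) (β := β) hαβ (fun z => ZMod.stdAddChar (g z))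
        hbal fun i => G i w₁ w₂ + T i
      rw [← h]
      refine Fintype.sum_bijective R hR _ _ fun t => ?_
      simp only [k]
      congr 2
      ring
    refine ⟨fun w₁ w₂ v₁ v₂ => g (k w₁ w₂ (-(v₂ * v₁⁻¹))), fun w₁ w₂ v₁ v₂ => ?_⟩
    have hterm : ∀ x₁ x₂ y₁ y₂, zetaP p (g (H x₁ x₂ y₁ y₂)
        - (absTr p n (w₁ * x₁ + w₂ * x₂) + absTr p m (v₁ * y₁ + v₂ * y₂))) =
        ZMod.stdAddChar (g (H x₁ x₂ y₁ y₂)) * galoisChar p n (-(w₁ * x₁ + w₂ * x₂)) *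
          galoisChar p m (-(v₁ * y₁ + v₂ * y₂)) := fun x₁ x₂ y₁ y₂ => by
      rw [zetaP_eq_stdAddChar, AddChar.map_neg_eq_inv, AddChar.map_neg_eq_inv, galoisChar_apply,
        galoisChar_apply, ← AddChar.map_neg_eq_inv, ← AddChar.map_neg_eq_inv,
        ← AddChar.map_add_eq_mul, ← AddChar.map_add_eq_mul]
      congr 1
      ring
    have hG' := fun i c => hG i w₁ w₂ (fun z => ZMod.stdAddChar (g z)) hbal c
    rw [sum_comm_pairs]
    simp_rw [hterm, ← Finset.sum_mul, hH, add_assoc, hG', mul_assoc, ← Finset.mul_sum]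
    rw [sum_spread_mul_addChar (isPrimitive_galoisChar p m)
      (fun t => ZMod.stdAddChar (g (k w₁ w₂ t))) (hk w₁ w₂), card_galoisField p hn,
      card_galoisField p hm, zetaP_eq_stdAddChar, pow_add, mul_assoc]
    push_cast
    rfl
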